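/- Let k ≥ 1 and suppose p is a proper period of the prefix t[0..k−1] of the Thue–Morse word, i.e., p < k and p is a period of t[0..k−1]. Write p = m·2^n with m odd and n ≥ 0. Then: (i) m ≠ 1; (ii) if m = 3 then k ≤ 5·2^n; (iii) if m = 5 then k ≤ 6·2^n. -/

import Mathlib

/-- The Thue–Morse word: `tm n` is the parity of the number of 1s in the
binary representation of `n` (`true` = letter 1, `false` = letter 0). -/
def tm (n : ℕ) : Bool := ((Nat.digits 2 n).count 1) % 2 == 1

/-- The factor `t[ℓ..ℓ+k-1]` of the Thue–Morse word. -/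
def tmFactor (ℓ k : ℕ) : List Bool := (List.range k).map (fun i => tm (ℓ + i))

/-- Complement of a binary word (exchange 0 and 1 in every position). -/
def wcompl (w : List Bool) : List Bool := w.map (fun b => !b)

/-- Apply the binary morphism `0 ↦ h0, 1 ↦ h1` to the word `w`. -/
def applyMorph (h0 h1 : List Bool) (w : List Bool) : List Bool :=
  (w.map (fun b => bif b then h1 else h0)).flatten

/-- The Thue–Morse morphism μ : 0 ↦ 01, 1 ↦ 10. -/
def mu : List Bool → List Bool := applyMorph [false, true] [true, false]

/-- `p` is a period of the finite word `w`: `1 ≤ p ≤ |w|` and `w[i] = w[i+p]`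
for all `i` with `i + p < |w|`. -/
def HasPeriodW (w : List Bool) (p : ℕ) : Prop :=
  1 ≤ p ∧ p ≤ w.length ∧ ∀ i, i + p < w.length → w.getD i false = w.getD (i + p) false

/-- The smallest period of `w`. -/
noncomputable def per (w : List Bool) : ℕ := sInf {p | HasPeriodW w p}

/-- The exponent of `w`: `|w| / per(w)`. -/
noncomputable def wexp (w : List Bool) : ℝ := (w.length : ℝ) / (per w : ℝ)

/-- The critical exponent of `w`: supremum of exponents of nonempty factors of `w`. -/
noncomputable def ce (w : List Bool) : ℝ :=
  sSup {r : ℝ | ∃ x : List Bool, x ≠ [] ∧ x <:+: w ∧ r = wexp x}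

/-- A `k`-prefix: the length-`k` prefix of the Thue–Morse word, or its complement. -/
def kPrefix (k : ℕ) (s : List Bool) : Prop :=
  s = tmFactor 0 k ∨ s = wcompl (tmFactor 0 k)

/-- `v` is a finite factor of the Thue–Morse word. -/
def IsTMFactor (v : List Bool) : Prop := ∃ ℓ, v = tmFactor ℓ v.length

/-- The complementary morphism `0 ↦ h0, 1 ↦ complement of h0` is cubefree:
it maps every word of critical exponent `< 3` to a word of critical exponent `< 3`. -/
def CubefreeC (h0 : List Bool) : Prop :=
  ∀ w : List Bool, ce w < 3 → ce (applyMorph h0 (wcompl h0) w) < 3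

/-- The word `x` occurs at position `i` of the word `w`. -/
def OccursAt (x w : List Bool) (i : ℕ) : Prop :=
  i + x.length ≤ w.length ∧ (w.drop i).take x.length = x

theorem tm_two_mul (a : ℕ) : tm (2 * a) = tm a := by
  rcases Nat.eq_zero_or_pos a with rfl | ha
  · rfl
  · have h := Nat.digits_add_two_add_one 0 (2 * a - 1)
    have e : 2 * a - 1 + 1 = 2 * a := by omega
    rw [e] at h
    simp [tm, h]

theorem tm_mul_two_pow (j n : ℕ) : tm (j * 2 ^ n) = tm j := by
  induction n with
  | zero => simp
  | succ n ih => rw [show j * 2 ^ (n + 1) = 2 * (j * 2 ^ n) by ring, tm_two_mul, ih]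

theorem length_tmFactor (l k : ℕ) : (tmFactor l k).length = k := by
  simp [tmFactor]

theorem getD_tmFactor {l k i : ℕ} (h : i < k) : (tmFactor l k).getD i false = tm (l + i) := by
  simp [tmFactor, List.getD, h]

theorem tm_eq_of_hasPeriodW {k m n j : ℕ} (hper : HasPeriodW (tmFactor 0 k) (m * 2 ^ n))
    (h : (j + m) * 2 ^ n < k) : tm j = tm (j + m) := by
  rw [add_mul] at h
  have key := hper.2.2 (j * 2 ^ n) (by rwa [length_tmFactor])
  rw [getD_tmFactor (by omega), getD_tmFactor h, zero_add, zero_add, ← add_mul,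
    tm_mul_two_pow, tm_mul_two_pow] at key
  exact key

/-- if `p` is a proper period of the Thue–Morse prefix `t[0..k-1]`
and `p = m·2ⁿ` with `m` odd, then `m ≠ 1`; if `m = 3` then `k ≤ 5·2ⁿ`; and if
`m = 5` then `k ≤ 6·2ⁿ`. -/
theorem stmt8 (k p m n : ℕ) (hk : 1 ≤ k) (hpk : p < k)
    (hper : HasPeriodW (tmFactor 0 k) p) (hm : Odd m) (hp : p = m * 2 ^ n) :
    m ≠ 1 ∧ (m = 3 → k ≤ 5 * 2 ^ n) ∧ (m = 5 → k ≤ 6 * 2 ^ n) := by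
  subst hp
  refine ⟨?_, ?_, ?_⟩
  · rintro rfl
    have h := tm_eq_of_hasPeriodW (j := 0) hper (by simpa using hpk)
    norm_num [tm] at h
  · rintro rfl
    by_contra! hlt
    have h := tm_eq_of_hasPeriodW (j := 2) hper hlt
    norm_num [tm] at h
  · rintro rfl
    by_contra! hlt
    have h := tm_eq_of_hasPeriodW (j := 1) hper hlt
    norm_num [tm] at h
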